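/- Fix integers l ≥ 1 and e ≥ 2, let s ∈ S_e and let λ be an l-partition such that (λ,s) is cylindric. Then for every i ∈ {0,…,e−1}: if λ has a good addable i-node γ, the l-partition obtained by adding γ to λ is again cylindric (with the same charge s); and if λ has a good removable i-node γ, the l-partition obtained by removing γ from λ is again cylindric. In other words, the set of cylindric l-partitions charged by s is stable under the crystal operators f̃_i and ẽ_i. -/

import Mathlib

namespace FockCrystal

/-- A partition: `part a` is the `a`-th part, for `a ≥ 1`; `part 0` is a dummy value `0`. -/
structure Partition where
  part : ℕ → ℕ
  part_zero : part 0 = 0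
  antitone : ∀ a : ℕ, 1 ≤ a → part (a + 1) ≤ part a
  eventually_zero : ∃ N : ℕ, ∀ a : ℕ, N ≤ a → part a = 0

/-- A multipartition with `l + 1` components. -/
abbrev MultiPartition (l : ℕ) := Fin (l + 1) → Partition

/-- A node `(a, b, c)`: row `a ≥ 1`, column `b ≥ 1`, component `c`. -/
structure Node (l : ℕ) where
  row : ℕ
  col : ℕ
  comp : Fin (l + 1)

variable {l : ℕ}

def IsNode (Λ : MultiPartition l) (γ : Node l) : Prop :=
  1 ≤ γ.row ∧ 1 ≤ γ.col ∧ γ.col ≤ (Λ γ.comp).part γ.row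

/-- The content `b − a + s_c` of a node. -/
def content (s : Fin (l + 1) → ℤ) (γ : Node l) : ℤ :=
  (γ.col : ℤ) - (γ.row : ℤ) + s γ.comp

/-- `γ` is a removable node of `Λ`. -/
def Removable (Λ : MultiPartition l) (γ : Node l) : Prop :=
  1 ≤ γ.row ∧ 1 ≤ γ.col ∧ γ.col = (Λ γ.comp).part γ.row ∧
    (Λ γ.comp).part (γ.row + 1) < (Λ γ.comp).part γ.row

/-- `γ` is an addable node of `Λ`. -/
def Addable (Λ : MultiPartition l) (γ : Node l) : Prop :=
  1 ≤ γ.row ∧ γ.col = (Λ γ.comp).part γ.row + 1 ∧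
    (γ.row = 1 ∨ (Λ γ.comp).part γ.row < (Λ γ.comp).part (γ.row - 1))

/-- The strict order `≺_s` on nodes. -/
def NodeLt (s : Fin (l + 1) → ℤ) (γ γ' : Node l) : Prop :=
  content s γ < content s γ' ∨ (content s γ = content s γ' ∧ γ'.comp < γ.comp)

inductive Letter | A | R
  deriving DecidableEq

/-- The letter attached to a node is `A` iff the node is addable, `R` iff removable. -/
def LetterOk (Λ : MultiPartition l) (p : Node l × Letter) : Prop :=
  (p.2 = Letter.A ↔ Addable Λ p.1) ∧ (p.2 = Letter.R ↔ Removable Λ p.1)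

/-- `w` is the `i`-word of `(Λ, s)` for the residue-mod-`e` structure: the list of
addable/removable nodes of residue `i`, in increasing `≺_s`-order, with letters A/R. -/
def IsWordE (Λ : MultiPartition l) (s : Fin (l + 1) → ℤ) (e : ℕ) (i : ℤ)
    (w : List (Node l × Letter)) : Prop :=
  w.Pairwise (fun p q => NodeLt s p.1 q.1) ∧
  (∀ γ : Node l, (∃ x, (γ, x) ∈ w) ↔
      ((Addable Λ γ ∨ Removable Λ γ) ∧ content s γ % (e : ℤ) = i)) ∧
  ∀ p ∈ w, LetterOk Λ p

/-- `w` is the `j`-word of `(Λ, s)` for the `e = ∞` structure: the list of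
addable/removable nodes of content `j`, in increasing `≺_s`-order, with letters A/R. -/
def IsWordInf (Λ : MultiPartition l) (s : Fin (l + 1) → ℤ) (j : ℤ)
    (w : List (Node l × Letter)) : Prop :=
  w.Pairwise (fun p q => NodeLt s p.1 q.1) ∧
  (∀ γ : Node l, (∃ x, (γ, x) ∈ w) ↔
      ((Addable Λ γ ∨ Removable Λ γ) ∧ content s γ = j)) ∧
  ∀ p ∈ w, LetterOk Λ p

/-- Recursive cancellation of all factors `RA` in a word (of nodes with letters). -/
def reduceW : List (Node l × Letter) → List (Node l × Letter)
  | [] => []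
  | p :: ps =>
    match reduceW ps with
    | [] => [p]
    | q :: qs => if p.2 = Letter.R ∧ q.2 = Letter.A then qs else p :: q :: qs

/-- `γ` is the node encoded by the rightmost `A` of the reduced word of `w`. -/
def GoodAddableWord (w : List (Node l × Letter)) (γ : Node l) : Prop :=
  ∃ u v, reduceW w = u ++ (γ, Letter.A) :: v ∧ ∀ p ∈ v, p.2 = Letter.R

/-- `γ` is the node encoded by the leftmost `R` of the reduced word of `w`. -/
def GoodRemovableWord (w : List (Node l × Letter)) (γ : Node l) : Prop :=
  ∃ u v, reduceW w = u ++ (γ, Letter.R) :: v ∧ ∀ p ∈ u, p.2 = Letter.A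

/-- `γ` is the good addable `i`-node of `(Λ, s)` for the residue-mod-`e` structure. -/
def GoodAddable (Λ : MultiPartition l) (s : Fin (l + 1) → ℤ) (e : ℕ) (i : ℤ)
    (γ : Node l) : Prop :=
  ∃ w, IsWordE Λ s e i w ∧ GoodAddableWord w γ

/-- `γ` is the good removable `i`-node of `(Λ, s)` for the residue-mod-`e` structure. -/
def GoodRemovable (Λ : MultiPartition l) (s : Fin (l + 1) → ℤ) (e : ℕ) (i : ℤ)
    (γ : Node l) : Prop :=
  ∃ w, IsWordE Λ s e i w ∧ GoodRemovableWord w γ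

/-- `γ` is the good addable `j`-node of `(Λ, s)` for the `e = ∞` structure. -/
def GoodAddableInf (Λ : MultiPartition l) (s : Fin (l + 1) → ℤ) (j : ℤ)
    (γ : Node l) : Prop :=
  ∃ w, IsWordInf Λ s j w ∧ GoodAddableWord w γ

/-- `Λ'` is obtained from `Λ` by adding the node `γ`. -/
def AddNode (Λ Λ' : MultiPartition l) (γ : Node l) : Prop :=
  (Λ' γ.comp).part γ.row = (Λ γ.comp).part γ.row + 1 ∧
  (∀ a : ℕ, a ≠ γ.row → (Λ' γ.comp).part a = (Λ γ.comp).part a) ∧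
  ∀ c, c ≠ γ.comp → Λ' c = Λ c

/-- `s ∈ S_e`: `0 ≤ s_c − s_{c'} < e` whenever `c' < c`. -/
def InSe (e : ℕ) (s : Fin (l + 1) → ℤ) : Prop :=
  ∀ c' c : Fin (l + 1), c' < c → 0 ≤ s c - s c' ∧ s c - s c' < (e : ℤ)

/-- `s ∈ D_e`: `0 ≤ s_1 ≤ … ≤ s_l < e`. -/
def InDe (e : ℕ) (s : Fin (l + 1) → ℤ) : Prop :=
  (∀ c, 0 ≤ s c ∧ s c < (e : ℤ)) ∧ Monotone s

/-- The rotation `c ↦ c + 1` of components. -/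
def rho (l : ℕ) : Equiv.Perm (Fin (l + 1)) := finRotate (l + 1)

/-- The cyclage on multicharges: `ξ(s) = (s_l − e, s_1, …, s_{l−1})`. -/
def xiCharge (e : ℕ) (s : Fin (l + 1) → ℤ) : Fin (l + 1) → ℤ :=
  fun c => s ((rho l).symm c) - if c = 0 then (e : ℤ) else 0

/-- The cyclage on multipartitions: `ξ(λ) = (λ^l, λ^1, …, λ^{l−1})`. -/
def xiMP (Λ : MultiPartition l) : MultiPartition l := fun c => Λ ((rho l).symm c)

/-- The corresponding bijection on nodes: `(a,b,c) ↦ (a,b,c+1)` cyclically. -/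
def xiNode (γ : Node l) : Node l := ⟨γ.row, γ.col, rho l γ.comp⟩

/-- The component preceding `c` (cyclically). -/
def prevComp {l : ℕ} (c : Fin (l + 1)) : Fin (l + 1) := (rho l).symm c

/-- `(Λ, s)` is cylindric. -/
def Cylindric (e : ℕ) (s : Fin (l + 1) → ℤ) (Λ : MultiPartition l) : Prop :=
  (∀ c : Fin l, ∀ a : ℕ, 1 ≤ a →
      (Λ c.succ).part (a + (s c.succ - s c.castSucc).toNat) ≤ (Λ c.castSucc).part a) ∧
  ∀ a : ℕ, 1 ≤ a →
      (Λ 0).part (a + ((e : ℤ) + s 0 - s (Fin.last l)).toNat) ≤ (Λ (Fin.last l)).part a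

/-- `γ` is the rightmost node of a part of `Λ` of size `α`. -/
def RightmostAt (Λ : MultiPartition l) (α : ℕ) (γ : Node l) : Prop :=
  1 ≤ γ.row ∧ γ.col = α ∧ (Λ γ.comp).part γ.row = α

/-- The residues of the rightmost nodes of the parts of size `α` cover `{0,…,e−1}`. -/
def Covers (e : ℕ) (s : Fin (l + 1) → ℤ) (Λ : MultiPartition l) (α : ℕ) : Prop :=
  ∀ r : ℤ, 0 ≤ r → r < (e : ℤ) →
    ∃ γ : Node l, RightmostAt Λ α γ ∧ content s γ % (e : ℤ) = r

/-- `(Λ, s)` is FLOTW. -/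
def FLOTW (e : ℕ) (s : Fin (l + 1) → ℤ) (Λ : MultiPartition l) : Prop :=
  Cylindric e s Λ ∧ ∀ α : ℕ, 1 ≤ α → ¬ Covers e s Λ α

/-- `P 0, …, P (e−1)` is the first pseudoperiod of `(Λ, s)`, of width `α`. -/
def IsFirstPseudoperiod (e : ℕ) (s : Fin (l + 1) → ℤ) (Λ : MultiPartition l)
    (α : ℕ) (P : ℕ → Node l) : Prop :=
  1 ≤ α ∧ Covers e s Λ α ∧ (∀ β : ℕ, α < β → ¬ Covers e s Λ β) ∧
  (∀ i, i < e → RightmostAt Λ α (P i)) ∧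
  (∀ γ, RightmostAt Λ α γ → content s γ ≤ content s (P 0)) ∧
  (∀ γ, RightmostAt Λ α γ → content s γ = content s (P 0) → (P 0).comp ≤ γ.comp) ∧
  ∀ i : ℕ, i + 1 < e →
    content s (P (i + 1)) < content s (P i) ∧
    (∀ γ, RightmostAt Λ α γ → content s γ < content s (P i) →
        content s γ ≤ content s (P (i + 1))) ∧
    ∀ γ, RightmostAt Λ α γ → content s γ = content s (P (i + 1)) →
        (P (i + 1)).comp ≤ γ.comp

/-- `γ` is one of the nodes of the pseudoperiod `P` (of length `e`). -/
def InPseudo (e : ℕ) (P : ℕ → Node l) (γ : Node l) : Prop := ∃ i, i < e ∧ P i = γ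

/-- The number of parts of `π` equal to `v`. -/
noncomputable def countParts (π : Partition) (v : ℕ) : ℕ :=
  Nat.card {a : ℕ // 1 ≤ a ∧ π.part a = v}

/-- `N^{>α}_c`: the number of parts of `Λ^c` greater than `α`. -/
noncomputable def NgtA (Λ : MultiPartition l) (α : ℕ) (c : Fin (l + 1)) : ℕ :=
  Nat.card {a : ℕ // 1 ≤ a ∧ α < (Λ c).part a}

/-- `N^α_c`: the number of parts of `Λ^c` (equal to `α`) whose rightmost node is in `P`. -/
noncomputable def NalP (e : ℕ) (P : ℕ → Node l) (c : Fin (l + 1)) : ℕ :=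
  Nat.card {i : ℕ // i < e ∧ (P i).comp = c}

/-- The number of rows of component `c` above row `r` whose rightmost node is in `P`. -/
noncomputable def PAbove (e : ℕ) (P : ℕ → Node l) (c : Fin (l + 1)) (r : ℕ) : ℕ :=
  Nat.card {i : ℕ // i < e ∧ (P i).comp = c ∧ (P i).row < r}

/-- `μ = ψ(Λ)`: for each component `C`, `μ^C` consists of the parts of `Λ^C` smaller
than `α`, the parts of `Λ^C` equal to `α` whose rightmost node is not in `P`, and the
parts of `Λ^{C−1}` (cyclically) greater than `α`; specified via part multiplicities. -/
def IsPsi (e : ℕ) (P : ℕ → Node l) (α : ℕ) (Λ μ : MultiPartition l) : Prop :=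
  ∀ C : Fin (l + 1), ∀ v : ℕ, 1 ≤ v →
    countParts (μ C) v =
      if v < α then countParts (Λ C) v
      else if v = α then countParts (Λ C) α - NalP e P C
      else countParts (Λ (prevComp C)) v

/-- The canonical association between nodes of `Λ` (outside the rows of `P`) and
nodes of `ψ(Λ)`: boxes of parts `> α` keep their row and move one component up
(cyclically), boxes of kept parts `≤ α` stay in their component, their row being
shifted by the number of rows removed above minus the number of rows inserted above. -/
def CanonAssoc (e : ℕ) (Λ : MultiPartition l) (α : ℕ) (P : ℕ → Node l)
    (γ Γ : Node l) : Prop :=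
  Γ.col = γ.col ∧
  ( (α < (Λ γ.comp).part γ.row ∧ Γ.comp = rho l γ.comp ∧ Γ.row = γ.row)
  ∨ ((Λ γ.comp).part γ.row ≤ α ∧
      (∀ i, i < e → ¬ ((P i).comp = γ.comp ∧ (P i).row = γ.row)) ∧
      Γ.comp = γ.comp ∧
      Γ.row + NgtA Λ α γ.comp + PAbove e P γ.comp γ.row
        = γ.row + NgtA Λ α (prevComp γ.comp)) )

/-- The entry of the `s`-symbol of `Λ` of size `p` in row `c` and column `k`
(`1 ≤ k ≤ p + s_c`): `b^c_a = λ^c_a − a + p + s_c` with `a = p + s_c − k + 1`. -/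
def symbolEntry (s : Fin (l + 1) → ℤ) (Λ : MultiPartition l) (p : ℤ)
    (c : Fin (l + 1)) (k : ℕ) : ℤ :=
  ((Λ c).part (p + s c - (k : ℤ) + 1).toNat : ℤ) - (p + s c - (k : ℤ) + 1) + p + s c

/-- `p` is an admissible size for the `s`-symbol of `Λ`:
`p ≥ 1 − s_c + h(λ^c)` for all `c`. -/
def SizeOK (s : Fin (l + 1) → ℤ) (Λ : MultiPartition l) (p : ℤ) : Prop :=
  ∀ c, 1 ≤ p + s c ∧ ∀ a : ℕ, p + s c ≤ (a : ℤ) → (Λ c).part a = 0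

/-- The `s`-symbol of `Λ` of size `p` is semistandard: `s` is non-decreasing, the
entries in each column are non-decreasing (read from the row with the larger index
down to the row with the smaller one), and the entries in each row are increasing. -/
def SemistandardAt (s : Fin (l + 1) → ℤ) (Λ : MultiPartition l) (p : ℤ) : Prop :=
  Monotone s ∧
  (∀ c c' : Fin (l + 1), c < c' → ∀ k : ℕ, 1 ≤ k → (k : ℤ) ≤ p + s c →
      symbolEntry s Λ p c' k ≤ symbolEntry s Λ p c k) ∧
  ∀ c, ∀ k : ℕ, 1 ≤ k → (k : ℤ) + 1 ≤ p + s c →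
      symbolEntry s Λ p c k < symbolEntry s Λ p c (k + 1)

/-- The `s`-symbol of `Λ` is semistandard (for every admissible size). -/
def Semistandard (s : Fin (l + 1) → ℤ) (Λ : MultiPartition l) : Prop :=
  ∀ p : ℤ, SizeOK s Λ p → SemistandardAt s Λ p

/-- The index of the column of the symbol of size `p` containing the entry
corresponding to the node `γ`. -/
def colOf (s : Fin (l + 1) → ℤ) (p : ℤ) (γ : Node l) : ℤ :=
  p + s γ.comp - (γ.row : ℤ) + 1


/-- The reduced word consists of letters of the word. -/
lemma mem_of_mem_reduceW {w : List (Node l × Letter)} {q : Node l × Letter}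
    (h : q ∈ reduceW w) : q ∈ w := by
  induction w with
  | nil => simp [reduceW] at h
  | cons x w ih =>
    rw [reduceW] at h
    split at h
    · simp_all
    · rename_i y ys hy
      rw [hy] at ih
      split_ifs at h
      · exact List.mem_cons_of_mem _ (ih (List.mem_cons_of_mem _ h))
      · rcases List.mem_cons.1 h with rfl | h
        · exact List.mem_cons_self
        · exact List.mem_cons_of_mem _ (ih h)

/-- Prepending a word to `w'` only cancels some initial letters `A` of `reduceW w'`. -/
lemma reduceW_append (w w' : List (Node l × Letter)) :
    ∃ p d t, reduceW w' = d ++ t ∧ reduceW (w ++ w') = p ++ t ∧ (∀ q ∈ p, q ∈ w) ∧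
      ∀ q ∈ d, q.2 = Letter.A := by
  induction w with
  | nil => exact ⟨[], [], reduceW w', by simp⟩
  | cons x w ih =>
    obtain ⟨p, d, t, h₁, h₂, h₃, h₄⟩ := ih
    rw [List.cons_append, reduceW, h₂]
    rcases p with _ | ⟨y, p⟩
    · rcases t with _ | ⟨y, t⟩
      · exact ⟨[x], d, [], h₁, by simp, by simp, h₄⟩
      · by_cases hxy : x.2 = Letter.R ∧ y.2 = Letter.A
        · refine ⟨[], d ++ [y], t, by simp [h₁], by simp [hxy], by simp, ?_⟩
          intro q hq
          rcases List.mem_append.1 hq with hq | hq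
          · exact h₄ q hq
          · rw [List.mem_singleton.1 hq]
            exact hxy.2
        · exact ⟨[x], d, y :: t, h₁, by simp [hxy], by simp, h₄⟩
    · by_cases hxy : x.2 = Letter.R ∧ y.2 = Letter.A
      · refine ⟨p, d, t, h₁, by simp [hxy], fun q hq => ?_, h₄⟩
        exact List.mem_cons_of_mem _ (h₃ q (List.mem_cons_of_mem _ hq))
      · refine ⟨x :: y :: p, d, t, h₁, by simp [hxy], fun q hq => ?_, h₄⟩
        rcases List.mem_cons.1 hq with rfl | hq
        · exact List.mem_cons_self
        · exact List.mem_cons_of_mem _ (h₃ q hq)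

/-- An `A` immediately followed by another `A` is not the rightmost `A` of the reduced word. -/
lemma not_goodAddableWord_of_adjacent {w w' : List (Node l × Letter)} {γ δ : Node l}
    (hnd : (w ++ (γ, Letter.A) :: (δ, Letter.A) :: w').Nodup) :
    ¬ GoodAddableWord (w ++ (γ, Letter.A) :: (δ, Letter.A) :: w') γ := by
  rintro ⟨u, v, huv, hv⟩
  have hcons : ∀ (η : Node l) (x : List (Node l × Letter)),
      reduceW ((η, Letter.A) :: x) = (η, Letter.A) :: reduceW x := by
    intro η x
    rw [reduceW]
    split <;> simp_all
  obtain ⟨p, d, t, h₁, h₂, h₃, -⟩ := reduceW_append w ((γ, Letter.A) :: (δ, Letter.A) :: w')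
  rw [hcons, hcons] at h₁
  rw [List.nodup_append'] at hnd
  obtain ⟨-, hnd', hdisj⟩ := hnd
  have hγw : (γ, Letter.A) ∉ w := fun h => hdisj h List.mem_cons_self
  have hγr : (γ, Letter.A) ∉ (δ, Letter.A) :: reduceW w' := by
    intro h
    rcases List.mem_cons.1 h with h | h
    · exact (List.nodup_cons.1 hnd').1 (by simp [h])
    · exact (List.nodup_cons.1 hnd').1 (List.mem_cons_of_mem _ (mem_of_mem_reduceW h))
  have hγp : (γ, Letter.A) ∉ p := fun h => hγw (h₃ _ h)
  rw [h₂] at huv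
  rcases d with _ | ⟨z, d⟩
  · rw [List.nil_append] at h₁
    subst h₁
    have key := (List.append_cons_inj_of_notMem hγp hγr).1 huv
    rw [← key.2.2] at hv
    exact absurd (hv _ List.mem_cons_self) (by simp)
  · have hmem : (γ, Letter.A) ∈ p ++ t := by simp [huv]
    rw [List.cons_append, List.cons.injEq] at h₁
    rcases List.mem_append.1 hmem with h | h
    · exact hγp h
    · exact hγr (by rw [h₁.2]; exact List.mem_append_right _ h)

/-- An `R` immediately preceded by another `R` is not the leftmost `R` of the reduced word. -/
lemma not_goodRemovableWord_of_adjacent {w w' : List (Node l × Letter)} {γ δ : Node l}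
    (hnd : (w ++ (δ, Letter.R) :: (γ, Letter.R) :: w').Nodup) :
    ¬ GoodRemovableWord (w ++ (δ, Letter.R) :: (γ, Letter.R) :: w') γ := by
  rintro ⟨u, v, huv, hu⟩
  have hmem : (γ, Letter.R) ∈ reduceW (w ++ (δ, Letter.R) :: (γ, Letter.R) :: w') := by
    simp [huv]
  have hsplit : w ++ (δ, Letter.R) :: (γ, Letter.R) :: w' =
      (w ++ [(δ, Letter.R)]) ++ (γ, Letter.R) :: w' := by simp
  have hγ : (γ, Letter.R) ∉ w ++ [(δ, Letter.R)] ∧ (γ, Letter.R) ∉ w' := by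
    rw [hsplit, List.nodup_append'] at hnd
    exact ⟨fun h => hnd.2.2 h List.mem_cons_self, (List.nodup_cons.1 hnd.2.1).1⟩
  have hred : reduceW ((γ, Letter.R) :: w') = (γ, Letter.R) :: reduceW w' := by
    have hγr : (γ, Letter.R) ∈ reduceW ((γ, Letter.R) :: w') := by
      obtain ⟨p, d, t, h₁, h₂, h₃, -⟩ :=
        reduceW_append (w ++ [(δ, Letter.R)]) ((γ, Letter.R) :: w')
      rw [hsplit, h₂] at hmem
      rcases List.mem_append.1 hmem with h | h
      · exact absurd (h₃ _ h) hγ.1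
      · exact h₁ ▸ List.mem_append_right _ h
    have hsub := fun q => mem_of_mem_reduceW (w := w') (q := q)
    rw [reduceW] at hγr ⊢
    split at hγr
    · rename_i hy
      rw [hy]
    · rename_i y ys hy
      rw [hy] at hsub ⊢
      split_ifs at hγr with hc
      · exact absurd (hsub _ (List.mem_cons_of_mem _ hγr)) hγ.2
      · exact if_neg hc
  have hred' : reduceW ((δ, Letter.R) :: (γ, Letter.R) :: w') =
      (δ, Letter.R) :: (γ, Letter.R) :: reduceW w' := by
    rw [reduceW, hred]
    simp
  obtain ⟨p, d, t, h₁, h₂, h₃, h₄⟩ := reduceW_append w ((δ, Letter.R) :: (γ, Letter.R) :: w')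
  rw [hred'] at h₁
  rcases d with _ | ⟨z, d⟩
  · rw [List.nil_append] at h₁
    subst h₁
    rw [h₂] at huv
    have hsplit' : p ++ (δ, Letter.R) :: (γ, Letter.R) :: reduceW w' =
        (p ++ [(δ, Letter.R)]) ++ (γ, Letter.R) :: reduceW w' := by simp
    have hγp : (γ, Letter.R) ∉ p ++ [(δ, Letter.R)] := by
      intro h
      refine hγ.1 ?_
      rcases List.mem_append.1 h with h | h
      · exact List.mem_append_left _ (h₃ _ h)
      · exact List.mem_append_right _ h
    have hγr : (γ, Letter.R) ∉ reduceW w' := fun h => hγ.2 (mem_of_mem_reduceW h)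
    rw [hsplit'] at huv
    have key := (List.append_cons_inj_of_notMem hγp hγr).1 huv
    exact absurd (hu (δ, Letter.R) (key.1 ▸ by simp)) (by simp)
  · rw [List.cons_append, List.cons.injEq] at h₁
    exact absurd (h₄ z List.mem_cons_self) (by simp [← h₁.1])

lemma NodeLt.irrefl (s : Fin (l + 1) → ℤ) (γ : Node l) : ¬ NodeLt s γ γ := by
  simp [NodeLt]

lemma NodeLt.asymm {s : Fin (l + 1) → ℤ} {γ δ : Node l} (h : NodeLt s γ δ) :
    ¬ NodeLt s δ γ := by
  unfold NodeLt at *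
  omega

lemma IsWordE.nodup {Λ : MultiPartition l} {s : Fin (l + 1) → ℤ} {e : ℕ} {i : ℤ}
    {w : List (Node l × Letter)} (hw : IsWordE Λ s e i w) : w.Nodup :=
  hw.1.imp fun h => by
    rintro rfl
    exact NodeLt.irrefl s _ h

/-- Two letters of a word whose nodes have no node of the same residue between them are
adjacent. -/
lemma IsWordE.exists_eq_append {Λ : MultiPartition l} {s : Fin (l + 1) → ℤ} {e : ℕ} {i : ℤ}
    {w : List (Node l × Letter)} (hw : IsWordE Λ s e i w) {p q : Node l × Letter}
    (hp : p ∈ w) (hq : q ∈ w) (hpq : NodeLt s p.1 q.1)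
    (hbetween : ∀ z : Node l, content s z % (e : ℤ) = i →
      ¬ (NodeLt s p.1 z ∧ NodeLt s z q.1)) :
    ∃ u v, w = u ++ p :: q :: v := by
  obtain ⟨u, v, rfl⟩ := List.append_of_mem hp
  have hsort := hw.1
  rw [List.pairwise_append, List.pairwise_cons] at hsort
  obtain ⟨-, ⟨hpv, hv⟩, huv⟩ := hsort
  have hqv : q ∈ v := by
    rcases List.mem_append.1 hq with h | h
    · exact absurd (huv q h p List.mem_cons_self) hpq.asymm
    · rcases List.mem_cons.1 h with rfl | h
      · exact absurd hpq (NodeLt.irrefl s _)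
      · exact h
  obtain ⟨v₁, v₂, rfl⟩ := List.append_of_mem hqv
  rcases v₁ with _ | ⟨z, v₁⟩
  · exact ⟨u, v₂, rfl⟩
  · have hz : content s z.1 % (e : ℤ) = i := ((hw.2.1 z.1).1 ⟨z.2, by simp⟩).2
    refine absurd ⟨hpv z (by simp), ?_⟩ (hbetween z.1 hz)
    exact (List.pairwise_cons.1 hv).1 q (by simp)

lemma IsWordE.addable_mem {Λ : MultiPartition l} {s : Fin (l + 1) → ℤ} {e : ℕ} {i : ℤ}
    {w : List (Node l × Letter)} (hw : IsWordE Λ s e i w) {γ : Node l} (hγ : Addable Λ γ)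
    (hi : content s γ % (e : ℤ) = i) : (γ, Letter.A) ∈ w := by
  obtain ⟨x, hx⟩ := (hw.2.1 γ).2 ⟨Or.inl hγ, hi⟩
  have : x = Letter.A := (hw.2.2 _ hx).1.2 hγ
  exact this ▸ hx

lemma IsWordE.removable_mem {Λ : MultiPartition l} {s : Fin (l + 1) → ℤ} {e : ℕ} {i : ℤ}
    {w : List (Node l × Letter)} (hw : IsWordE Λ s e i w) {γ : Node l} (hγ : Removable Λ γ)
    (hi : content s γ % (e : ℤ) = i) : (γ, Letter.R) ∈ w := by
  obtain ⟨x, hx⟩ := (hw.2.1 γ).2 ⟨Or.inr hγ, hi⟩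
  have : x = Letter.R := (hw.2.2 _ hx).2.2 hγ
  exact this ▸ hx

/-- `(a + d, b, c₂)` is the immediate predecessor of `(a, b, c₁)` among the nodes of the same
residue, for all `a` and `b`. -/
structure Linked (e : ℕ) (s : Fin (l + 1) → ℤ) (c₁ c₂ : Fin (l + 1)) (d : ℕ) : Prop where
  lt : ∀ a b : ℕ, NodeLt s ⟨a + d, b, c₂⟩ ⟨a, b, c₁⟩
  residue : ∀ a b : ℕ,
    content s ⟨a + d, b, c₂⟩ % (e : ℤ) = content s ⟨a, b, c₁⟩ % (e : ℤ)
  not_between : ∀ (a b : ℕ) (z : Node l),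
    content s z % (e : ℤ) = content s ⟨a, b, c₁⟩ % (e : ℤ) →
      ¬ (NodeLt s ⟨a + d, b, c₂⟩ z ∧ NodeLt s z ⟨a, b, c₁⟩)

lemma linked_succ {e : ℕ} {s : Fin (l + 1) → ℤ} (hs : InSe e s) (c : Fin l) :
    Linked e s c.castSucc c.succ (s c.succ - s c.castSucc).toNat := by
  have h := (hs c.castSucc c.succ c.castSucc_lt_succ).1
  refine ⟨fun a b => ?_, fun a b => ?_, fun a b z _ => ?_⟩
  · refine Or.inr ⟨?_, c.castSucc_lt_succ⟩
    simp only [content]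
    omega
  · congr 1
    simp only [content]
    omega
  · simp only [NodeLt, content, Fin.lt_def, Fin.val_succ, Fin.val_castSucc]
    omega

lemma linked_last {e : ℕ} (he : 0 < e) {s : Fin (l + 1) → ℤ} (hs : InSe e s) :
    Linked e s (Fin.last l) 0 ((e : ℤ) + s 0 - s (Fin.last l)).toNat := by
  have h : s (Fin.last l) - s 0 < (e : ℤ) := by
    rcases eq_or_ne (Fin.last l) 0 with h | h
    · rw [h]
      omega
    · exact (hs 0 _ (Fin.pos_iff_ne_zero.2 h)).2
  have hc : ∀ a b : ℕ, content s ⟨a + ((e : ℤ) + s 0 - s (Fin.last l)).toNat, b, 0⟩ =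
      content s ⟨a, b, Fin.last l⟩ - e := by
    intro a b
    simp only [content]
    omega
  refine ⟨fun a b => Or.inl ?_, fun a b => ?_, fun a b z hz => ?_⟩
  · rw [hc]
    omega
  · rw [hc, Int.sub_emod_right]
  · rw [NodeLt, NodeLt, hc]
    rintro ⟨h₁ | h₁, h₂ | h₂⟩
    · have hdvd : (e : ℤ) ∣ content s ⟨a, b, Fin.last l⟩ - content s z :=
        Int.ModEq.dvd hz
      have := Int.le_of_dvd (by omega) hdvd
      omega
    · exact absurd h₂.2 (Fin.le_last _).not_gt
    · exact absurd h₁.2 (Fin.zero_le _).not_gt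
    · exact absurd h₁.2 (Fin.zero_le _).not_gt

/-- `Λ^{c₁}` dominates `Λ^{c₂}` shifted by `d` rows. -/
def Dominates (Λ : MultiPartition l) (c₁ c₂ : Fin (l + 1)) (d : ℕ) : Prop :=
  ∀ a : ℕ, 1 ≤ a → (Λ c₂).part (a + d) ≤ (Λ c₁).part a

lemma Linked.dominates_add {e : ℕ} {s : Fin (l + 1) → ℤ} {c₁ c₂ : Fin (l + 1)} {d : ℕ}
    (hL : Linked e s c₁ c₂ d) {Λ Λ' : MultiPartition l} (hΛ : Dominates Λ c₁ c₂ d) {i : ℤ}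
    {γ : Node l} (hγ : GoodAddable Λ s e i γ) (hadd : AddNode Λ Λ' γ) :
    Dominates Λ' c₁ c₂ d := by
  intro a ha
  have hpart : ∀ c a, (Λ c).part a ≤ (Λ' c).part a := by
    intro c a
    by_cases hc : c = γ.comp
    · subst hc
      by_cases hr : a = γ.row
      · rw [hr, hadd.1]
        omega
      · rw [hadd.2.1 a hr]
    · rw [hadd.2.2 c hc]
  by_cases hbox : c₂ = γ.comp ∧ a + d = γ.row
  swap
  · have heq : (Λ' c₂).part (a + d) = (Λ c₂).part (a + d) := by
      by_cases hc : c₂ = γ.comp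
      · subst hc
        exact hadd.2.1 _ fun h => hbox ⟨rfl, h⟩
      · rw [hadd.2.2 _ hc]
    rw [heq]
    exact (hΛ a ha).trans (hpart _ _)
  obtain ⟨row, col, comp⟩ := γ
  obtain ⟨rfl, rfl⟩ := hbox
  have hnew : (Λ' c₂).part (a + d) = (Λ c₂).part (a + d) + 1 := hadd.1
  rw [hnew]
  by_contra hlt
  have htight : (Λ c₁).part a = (Λ c₂).part (a + d) := by
    have := hpart c₁ a
    have := hΛ a ha
    omega
  obtain ⟨w, hw, hgood⟩ := hγ
  have hmem : (⟨a + d, col, c₂⟩, Letter.A) ∈ w := by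
    obtain ⟨u, v, huv, -⟩ := hgood
    exact mem_of_mem_reduceW (by simp [huv])
  have hγA : Addable Λ ⟨a + d, col, c₂⟩ := (hw.2.2 _ hmem).1.1 rfl
  have hres := ((hw.2.1 _).1 ⟨_, hmem⟩).2
  have hδA : Addable Λ ⟨a, col, c₁⟩ := by
    obtain ⟨-, hcol, hrow⟩ := hγA
    dsimp only at hcol hrow
    refine ⟨ha, by dsimp only; omega, ?_⟩
    dsimp only
    by_cases ha' : a = 1
    · exact Or.inl ha'
    · have := hΛ (a - 1) (by omega)
      rw [show a - 1 + d = a + d - 1 by omega] at this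
      omega
  have hδ := hw.addable_mem hδA ((hL.residue a col).symm.trans hres)
  obtain ⟨u, v, rfl⟩ := hw.exists_eq_append hmem hδ (hL.lt a col)
    fun z hz => hL.not_between a col z (by rw [hz, ← hL.residue, hres])
  exact not_goodAddableWord_of_adjacent hw.nodup hgood

lemma Linked.dominates_remove {e : ℕ} {s : Fin (l + 1) → ℤ} {c₁ c₂ : Fin (l + 1)} {d : ℕ}
    (hL : Linked e s c₁ c₂ d) {Λ Λ' : MultiPartition l} (hΛ : Dominates Λ c₁ c₂ d) {i : ℤ}
    {γ : Node l} (hγ : GoodRemovable Λ s e i γ) (hadd : AddNode Λ' Λ γ) :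
    Dominates Λ' c₁ c₂ d := by
  intro a ha
  have hpart : ∀ c a, (Λ' c).part a ≤ (Λ c).part a := by
    intro c a
    by_cases hc : c = γ.comp
    · subst hc
      by_cases hr : a = γ.row
      · rw [hr, hadd.1]
        omega
      · rw [hadd.2.1 a hr]
    · rw [hadd.2.2 c hc]
  by_cases hbox : c₁ = γ.comp ∧ a = γ.row
  swap
  · have heq : (Λ' c₁).part a = (Λ c₁).part a := by
      by_cases hc : c₁ = γ.comp
      · subst hc
        exact (hadd.2.1 _ fun h => hbox ⟨rfl, h⟩).symm
      · rw [hadd.2.2 _ hc]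
    rw [heq]
    exact (hpart _ _).trans (hΛ a ha)
  obtain ⟨row, col, comp⟩ := γ
  obtain ⟨rfl, rfl⟩ := hbox
  have hnew : (Λ c₁).part a = (Λ' c₁).part a + 1 := hadd.1
  by_contra hlt
  have htight : (Λ c₁).part a = (Λ c₂).part (a + d) := by
    have := hpart c₂ (a + d)
    have := hΛ a ha
    omega
  obtain ⟨w, hw, hgood⟩ := hγ
  have hmem : (⟨a, col, c₁⟩, Letter.R) ∈ w := by
    obtain ⟨u, v, huv, -⟩ := hgood
    exact mem_of_mem_reduceW (by simp [huv])
  have hγR : Removable Λ ⟨a, col, c₁⟩ := (hw.2.2 _ hmem).2.1 rfl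
  have hres := ((hw.2.1 _).1 ⟨_, hmem⟩).2
  have hδR : Removable Λ ⟨a + d, col, c₂⟩ := by
    obtain ⟨-, hpos, hcol, hrow⟩ := hγR
    dsimp only at hpos hcol hrow
    have := hΛ (a + 1) (by omega)
    rw [show a + 1 + d = a + d + 1 by omega] at this
    refine ⟨?_, hpos, ?_, ?_⟩ <;> dsimp only <;> omega
  have hδ := hw.removable_mem hδR ((hL.residue a col).trans hres)
  obtain ⟨u, v, rfl⟩ := hw.exists_eq_append hδ hmem (hL.lt a col)
    fun z hz => hL.not_between a col z (hz.trans hres.symm)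
  exact not_goodRemovableWord_of_adjacent hw.nodup hgood

/-!
STATEMENT 8: for s ∈ S_e, the set of cylindric l-partitions charged by s is stable
under the crystal operators: adding the good addable i-node or removing the good
removable i-node of a cylindric (λ, s) yields a cylindric multipartition.
-/
theorem cylindric_stable_under_crystal_operators
    (l e : ℕ) (he : 2 ≤ e) (s : Fin (l + 1) → ℤ) (Λ : MultiPartition l)
    (hs : InSe e s) (hcyl : Cylindric e s Λ) :
    ∀ i : ℕ, i < e →
      (∀ (γ : Node l) (Λ' : MultiPartition l),
          GoodAddable Λ s e (i : ℤ) γ → AddNode Λ Λ' γ → Cylindric e s Λ') ∧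
      (∀ (γ : Node l) (Λ' : MultiPartition l),
          GoodRemovable Λ s e (i : ℤ) γ → AddNode Λ' Λ γ → Cylindric e s Λ') := by
  have hlast := linked_last (by omega) hs
  refine fun i _ => ⟨fun γ Λ' hγ hadd => ⟨fun c => ?_, ?_⟩,
    fun γ Λ' hγ hadd => ⟨fun c => ?_, ?_⟩⟩
  · exact (linked_succ hs c).dominates_add (hcyl.1 c) hγ hadd
  · exact hlast.dominates_add hcyl.2 hγ hadd
  · exact (linked_succ hs c).dominates_remove (hcyl.1 c) hγ hadd
  · exact hlast.dominates_remove hcyl.2 hγ hadd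

end FockCrystal
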